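/- Let (R, 𝔪) be a Noetherian local ring with dim R > 0 and R/𝔪 infinite, let I be a proper ideal, and let M be a finitely generated R-module with dim_R M ≤ 1. Put 𝒫 = { 𝔭 ∈ Spec R : dim R/𝔭 = 1 and I ⊄ 𝔭 }. Then j_1(I, M) = Σ_{𝔭 ∈ 𝒫} length_{R_𝔭}(M_𝔭) · e(I; R/𝔭). -/

import Mathlib

open Filter

noncomputable section

/-- The length of a module, as the height of `⊤` in the submodule lattice. -/
def mLength (R M : Type*) [CommRing R] [AddCommGroup M] [Module R M] : ℕ∞ :=
  Order.height (⊤ : Submodule R M)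

/-- The Krull dimension of a module, via the annihilator. -/
def mDim (R M : Type*) [CommRing R] [AddCommGroup M] [Module R M] : WithBot ℕ∞ :=
  ringKrullDim (R ⧸ Module.annihilator R M)

/-- `H⁰_I(N)`: elements killed by a power of `I` (0-th local cohomology). -/
def H0 {R : Type*} [CommRing R] (I : Ideal R) (N : Type*) [AddCommGroup N] [Module R N] :
    Submodule R N :=
  ⨆ n : ℕ, Submodule.torsionBySet R N ((I ^ n : Ideal R) : Set R)

/-- `IⁿM/I^{n+1}M`, as a submodule of `M/I^{n+1}M`. -/
def gradedPiece {R : Type*} [CommRing R] (I : Ideal R) {M : Type*} [AddCommGroup M]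
    [Module R M] (n : ℕ) : Submodule R (M ⧸ (I ^ (n + 1) • ⊤ : Submodule R M)) :=
  Submodule.map (I ^ (n + 1) • ⊤ : Submodule R M).mkQ (I ^ n • ⊤ : Submodule R M)

/-- The `j`-multiplicity `j_d(I, M)`, defined as
`lim_n (d−1)!/n^(d−1) · length_R (H⁰_𝔪(IⁿM/I^{n+1}M))`. -/
def jMult {R : Type*} [CommRing R] (𝔪 I : Ideal R) (M : Type*) [AddCommGroup M]
    [Module R M] (d : ℕ) : ℝ :=
  limUnder atTop fun n : ℕ =>
    ((d - 1).factorial : ℝ) / (n : ℝ) ^ (d - 1) *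
      ((mLength R (H0 𝔪 (gradedPiece I (M := M) n))).toNat : ℝ)

/-- The Hilbert–Samuel multiplicity `e(I; N)` of a `d`-dimensional module `N`
(equal to `0` if `N = 0`), defined as `lim_n d!/n^d · length_R (N/IⁿN)`. -/
def hsMult {R : Type*} [CommRing R] (I : Ideal R) (N : Type*) [AddCommGroup N]
    [Module R N] (d : ℕ) : ℝ :=
  limUnder atTop fun n : ℕ =>
    (d.factorial : ℝ) / (n : ℝ) ^ d *
      ((mLength R (N ⧸ (I ^ n • ⊤ : Submodule R N))).toNat : ℝ)

/-- `K :_M I^∞ = ⋃ₙ (K :_M Iⁿ)`. -/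
def satur {R : Type*} [CommRing R] (I : Ideal R) {M : Type*} [AddCommGroup M] [Module R M]
    (K : Submodule R M) : Submodule R M :=
  Submodule.comap K.mkQ (H0 I (M ⧸ K))

/-- "For general elements `a₁, …, aᵢ` of `I`", i.e. for all `i`-tuples of elements of `I`
whose coefficient vectors with respect to any finite generating set of `I` avoid the zero
locus of some nonzero polynomial over the residue field `R/𝔪` (equivalently, whose images
lie in a suitable nonempty Zariski-open set of choices modulo `𝔪I`), property `P` holds. -/
def GeneralElts {R : Type*} [CommRing R] (𝔪 I : Ideal R) (i : ℕ)
    (P : (Fin i → R) → Prop) : Prop :=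
  ∀ (m : ℕ) (x : Fin m → R), Ideal.span (Set.range x) = I →
    ∃ F : MvPolynomial (Fin i × Fin m) R,
      MvPolynomial.map (Ideal.Quotient.mk 𝔪) F ≠ 0 ∧
      ∀ c : Fin i × Fin m → R,
        MvPolynomial.eval (fun p => Ideal.Quotient.mk 𝔪 (c p))
          (MvPolynomial.map (Ideal.Quotient.mk 𝔪) F) ≠ 0 →
        P fun j => ∑ l, c (j, l) * x l

theorem exists_forall_notMem_of_ne_top {R M ι : Type*} [CommRing R] [IsLocalRing R]
    [Infinite (IsLocalRing.ResidueField R)] [AddCommGroup M] [Module R M]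
    {s : Set ι} (hs : s.Finite) (p : ι → Submodule R M) (hp : ∀ i ∈ s, p i ≠ ⊤) :
    ∃ x : M, ∀ i ∈ s, x ∉ p i := by
  by_contra! hcov
  obtain ⟨k, hk, hfin⟩ := Submodule.exists_finiteIndex_of_cover (p := p) (s := hs.toFinset) <| by
    refine Set.eq_univ_of_forall fun x => ?_
    obtain ⟨i, hi, hx⟩ := hcov x
    simpa using ⟨i, hi, hx⟩
  have : Finite (M ⧸ p k) := AddSubgroup.finite_quotient_of_finiteIndex
  have : Nontrivial (M ⧸ p k) := Submodule.Quotient.nontrivial_iff.mpr (hp k (by simpa using hk))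
  obtain ⟨z, hz⟩ := exists_ne (0 : M ⧸ p k)
  refine Set.infinite_univ (α := IsLocalRing.ResidueField R) ?_
  have hle : LinearMap.ker (LinearMap.toSpanSingleton R _ z) ≤
      IsLocalRing.maximalIdeal R := by
    refine IsLocalRing.le_maximalIdeal fun h => hz ?_
    have : (1 : R) ∈ LinearMap.ker (LinearMap.toSpanSingleton R _ z) := h ▸ Submodule.mem_top
    simpa using this
  have hfin' : Finite (R ⧸ LinearMap.ker (LinearMap.toSpanSingleton R _ z)) :=
    Finite.of_injective _ (LinearMap.ker_eq_bot.mp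
      (Submodule.ker_liftQ_eq_bot _ (LinearMap.toSpanSingleton R _ z) le_rfl le_rfl))
  have : Finite (IsLocalRing.ResidueField R) :=
    Finite.of_surjective (Submodule.mapQ _ (IsLocalRing.maximalIdeal R) LinearMap.id hle)
      (fun y => by
        obtain ⟨r, rfl⟩ := Ideal.Quotient.mk_surjective y
        exact ⟨Submodule.Quotient.mk r, rfl⟩)
  exact Set.finite_univ

theorem eq_zero_of_smul_eq_zero_of_mem_pow_smul {A G : Type*} [CommRing A] [IsNoetherianRing A]
    [AddCommGroup G] [Module A G] [Module.Finite A G] (J : Ideal A) (t : A)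
    (ht : ∀ P ∈ associatedPrimes A G, t ∈ P → J ≤ P) :
    ∃ c : ℕ, ∀ n ≥ c, ∀ z ∈ (J ^ n • ⊤ : Submodule A G), t • z = 0 → z = 0 := by
  set K : Submodule A G := LinearMap.ker (LinearMap.lsmul A G t) with hK
  have hrad : J ≤ (Module.annihilator A K).radical := by
    rw [← Ideal.sInf_minimalPrimes]
    refine le_sInf fun P hP => ht P ?_ (hP.1.2 ?_)
    · exact associatedPrimes.subset_of_injective K.injective_subtype
        (Module.associatedPrimes.minimalPrimes_annihilator_subset_associatedPrimes A K hP)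
    · rw [Module.mem_annihilator]
      rintro ⟨z, hz⟩
      exact Subtype.ext hz
  obtain ⟨k, hk⟩ := Ideal.exists_pow_le_of_le_radical_of_fg hrad (IsNoetherian.noetherian J)
  obtain ⟨k₀, hk₀⟩ := J.exists_pow_inf_eq_pow_smul K
  refine ⟨k₀ + k, fun n hn z hz htz => ?_⟩
  have hmem : z ∈ J ^ (n - k₀) • (J ^ k₀ • ⊤ ⊓ K) := by
    rw [← hk₀ n (by lia)]
    exact ⟨hz, htz⟩
  have hbot : J ^ (n - k₀) • (J ^ k₀ • ⊤ ⊓ K) ≤ ⊥ := by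
    refine Submodule.smul_le.mpr fun r hr y hy => ?_
    have := Module.mem_annihilator.mp (hk (Ideal.pow_le_pow_right (by lia : k ≤ n - k₀) hr))
      ⟨y, hy.2⟩
    exact congrArg Subtype.val this
  exact hbot hmem

theorem exists_superficial_element_of_filtered {R M A P : Type*} [CommRing R] [IsLocalRing R]
    [Infinite (IsLocalRing.ResidueField R)] [AddCommGroup M] [Module R M] (I : Ideal R)
    [CommRing A] [IsNoetherianRing A] [Algebra R A] [AddCommGroup P] [Module A P]
    (E F : Submodule A P) (hEfg : E.FG) (t : I →ₗ[R] A) (s : ℕ → M →+ P)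
    (hst : ∀ (x : I) (n : ℕ) (y : M), t x • s n y = s (n + 1) ((x : R) • y))
    (hE : ∀ n, ∀ y ∈ (I ^ n • ⊤ : Submodule R M), s n y ∈ E)
    (hF : ∀ n y, s n y ∈ F ↔ y ∈ (I ^ (n + 1) • ⊤ : Submodule R M)) :
    ∃ x ∈ I, ∃ c : ℕ, ∀ n ≥ c, ∀ y ∈ (I ^ n • ⊤ : Submodule R M),
      x • y ∈ (I ^ (n + 2) • ⊤ : Submodule R M) → y ∈ (I ^ (n + 1) • ⊤ : Submodule R M) := by
  let G : Submodule A (P ⧸ F) := E.map F.mkQ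
  have : Module.Finite A G := Module.Finite.iff_fg.mpr (hEfg.map _)
  let J : Ideal A := Ideal.span (Set.range t)
  have hpow : ∀ n, ∀ y ∈ (I ^ n • ⊤ : Submodule R M), s n y ∈ J ^ n • E := by
    intro n
    induction n with
    | zero => simpa using hE 0
    | succ n ih =>
      intro y hy
      rw [pow_succ', mul_smul] at hy
      induction hy using Submodule.smul_induction_on' with
      | smul r hr m hm =>
        rw [← hst ⟨r, hr⟩ n m, pow_succ', mul_smul]
        exact Submodule.smul_mem_smul (Ideal.subset_span ⟨_, rfl⟩) (ih m hm)
      | add y₁ h₁ y₂ h₂ ih₁ ih₂ =>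
        rw [map_add]
        exact add_mem ih₁ ih₂
  obtain ⟨x, hx⟩ := exists_forall_notMem_of_ne_top
    (s := {p ∈ associatedPrimes A G | ¬ J ≤ p})
    ((associatedPrimes.finite A G).subset (Set.sep_subset _ _))
    (fun p : Ideal A => (p.restrictScalars R).comap t) (by
      rintro p ⟨-, hp⟩ h
      refine hp (Ideal.span_le.mpr ?_)
      rintro _ ⟨x, rfl⟩
      exact (h ▸ Submodule.mem_top : x ∈ (p.restrictScalars R).comap t))
  obtain ⟨c, hc⟩ := eq_zero_of_smul_eq_zero_of_mem_pow_smul (G := G) J (t x)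
    (fun p hp htp => by
      by_contra hJ
      exact hx p ⟨hp, hJ⟩ htp)
  refine ⟨x, x.2, c, fun n hn y hy hxy => (hF n y).mp ?_⟩
  let z : G := ⟨F.mkQ (s n y), Submodule.mem_map_of_mem (hE n y hy)⟩
  have hz : z ∈ (J ^ n • ⊤ : Submodule A G) := by
    have h : F.mkQ (s n y) ∈ (J ^ n • ⊤ : Submodule A G).map G.subtype := by
      rw [Submodule.map_smul'', Submodule.map_top, Submodule.range_subtype,
        ← Submodule.map_smul'']
      exact Submodule.mem_map_of_mem (hpow n y hy)
    obtain ⟨z', hz', e⟩ := h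
    rwa [show z = z' from Subtype.ext e.symm]
  have htz : t x • z = 0 := by
    refine Subtype.ext ?_
    change t x • F.mkQ (s n y) = 0
    rw [← map_smul, hst, Submodule.mkQ_apply, Submodule.Quotient.mk_eq_zero, hF]
    exact hxy
  simpa [z, Submodule.Quotient.mk_eq_zero] using congrArg Subtype.val (hc n hn z hz htz)

open PolynomialModule in
/-- Existence of superficial elements over a local ring with infinite residue field. -/
theorem exists_superficial_element {R : Type*} (M : Type*) [CommRing R] [IsNoetherianRing R]
    [IsLocalRing R] [Infinite (IsLocalRing.ResidueField R)] [AddCommGroup M] [Module R M]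
    [Module.Finite R M] (I : Ideal R) :
    ∃ x ∈ I, ∃ c : ℕ, ∀ n ≥ c, ∀ y ∈ (I ^ n • ⊤ : Submodule R M),
      x • y ∈ (I ^ (n + 2) • ⊤ : Submodule R M) → y ∈ (I ^ (n + 1) • ⊤ : Submodule R M) := by
  let E : I.Filtration M := I.stableFiltration ⊤
  let F : I.Filtration M :=
    { N := fun i => I ^ (i + 1) • ⊤
      mono := fun i => E.mono (i + 1)
      smul_le := fun i => E.smul_le (i + 1) }
  have hmem (H : I.Filtration M) (n : ℕ) (y : M) : single R n y ∈ H.submodule ↔ y ∈ H.N n := by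
    rw [Ideal.Filtration.mem_submodule]
    constructor
    · intro h
      simpa [coeff_single] using h n
    · intro h i
      rw [coeff_single, Finsupp.single_apply]
      split_ifs with hi
      · exact hi ▸ h
      · exact zero_mem _
  let t : I →ₗ[R] reesAlgebra I :=
    { toFun := fun x => ⟨Polynomial.monomial 1 (x : R),
        reesAlgebra.monomial_mem.mpr (by simp)⟩
      map_add' := fun x y => Subtype.ext (by simp)
      map_smul' := fun r x => Subtype.ext (by simp [Polynomial.smul_monomial]) }
  refine exists_superficial_element_of_filtered I E.submodule F.submodule
    ((E.submodule_fg_iff_stable fun i => IsNoetherian.noetherian _).mpr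
      (I.stableFiltration_stable ⊤)) t
    (fun n => (lsingle R n : M →ₗ[R] PolynomialModule R M).toAddMonoidHom) ?_
    (fun n y hy => (hmem E n y).mpr hy) (fun n y => hmem F n y)
  intro x n y
  change Polynomial.monomial 1 (x : R) • single R n y = single R (n + 1) ((x : R) • y)
  rw [monomial_smul_single, add_comm]

section Length

variable {R M : Type*} [CommRing R] [AddCommGroup M] [Module R M]

theorem mLength_eq_length (R M : Type*) [CommRing R] [AddCommGroup M] [Module R M] :
    mLength R M = Module.length R M :=
  (Module.length_eq_height R M).symm

theorem length_quotient_le_of_le {K L : Submodule R M} (h : K ≤ L) :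
    Module.length R (M ⧸ L) ≤ Module.length R (M ⧸ K) :=
  Module.length_le_of_surjective (Submodule.factor h) (Submodule.factor_surjective h)

theorem length_quotient_pow_succ (I : Ideal R) (n : ℕ) :
    Module.length R (M ⧸ (I ^ (n + 1) • ⊤ : Submodule R M)) =
      Module.length R (gradedPiece I (M := M) n) +
        Module.length R (M ⧸ (I ^ n • ⊤ : Submodule R M)) := by
  have hle : (I ^ (n + 1) • ⊤ : Submodule R M) ≤ I ^ n • ⊤ :=
    Submodule.smul_mono_left (Ideal.pow_le_pow_right n.le_succ)
  refine Module.length_eq_add_of_exact (gradedPiece I (M := M) n).subtype (Submodule.factor hle)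
    (Submodule.injective_subtype _) (Submodule.factor_surjective hle) ?_
  rw [LinearMap.exact_iff, Submodule.range_subtype]
  ext z
  obtain ⟨z, rfl⟩ := Submodule.mkQ_surjective _ z
  rw [LinearMap.mem_ker]
  change (I ^ n • ⊤ : Submodule R M).mkQ z = 0 ↔ _
  rw [Submodule.mkQ_apply, Submodule.Quotient.mk_eq_zero]
  refine ⟨fun h => Submodule.mem_map_of_mem h, ?_⟩
  rintro ⟨y, hy, hyz⟩
  have := hle ((Submodule.Quotient.eq _).mp hyz)
  simpa using sub_mem hy this

theorem length_quotient_map_smul (a : R) (ha : Function.Injective (LinearMap.lsmul R M a))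
    (B : Submodule R M) :
    Module.length R (M ⧸ B.map (LinearMap.lsmul R M a)) =
      Module.length R (M ⧸ B) +
        Module.length R (M ⧸ LinearMap.range (LinearMap.lsmul R M a)) := by
  have hle : B.map (LinearMap.lsmul R M a) ≤ LinearMap.range (LinearMap.lsmul R M a) :=
    LinearMap.map_le_range
  refine Module.length_eq_add_of_exact
    (Submodule.mapQ B (B.map (LinearMap.lsmul R M a)) (LinearMap.lsmul R M a)
      (Submodule.le_comap_map _ _)) (Submodule.factor hle) ?_
    (Submodule.factor_surjective hle) ?_
  · rw [← LinearMap.ker_eq_bot]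
    refine Submodule.ker_liftQ_eq_bot _ _ _ ?_
    rw [LinearMap.ker_comp, Submodule.ker_mkQ, Submodule.comap_map_eq_of_injective ha]
  · rw [LinearMap.exact_iff, Submodule.range_mapQ]
    ext z
    obtain ⟨z, rfl⟩ := Submodule.mkQ_surjective _ z
    rw [LinearMap.mem_ker]
    change (LinearMap.range (LinearMap.lsmul R M a)).mkQ z = 0 ↔ _
    rw [Submodule.mkQ_apply, Submodule.Quotient.mk_eq_zero]
    refine ⟨fun h => Submodule.mem_map_of_mem h, ?_⟩
    rintro ⟨y, hy, hyz⟩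
    have := hle ((Submodule.Quotient.eq _).mp hyz)
    simpa using sub_mem hy this

theorem length_gradedPiece_le (I : Ideal R) {a : R} (haI : a ∈ I)
    (ha : Function.Injective (LinearMap.lsmul R M a)) (n : ℕ)
    (hfin : Module.length R (M ⧸ (I ^ n • ⊤ : Submodule R M)) ≠ ⊤) :
    Module.length R (gradedPiece I (M := M) n) ≤
      Module.length R (M ⧸ LinearMap.range (LinearMap.lsmul R M a)) := by
  have hle : (I ^ n • ⊤ : Submodule R M).map (LinearMap.lsmul R M a) ≤ I ^ (n + 1) • ⊤ := by
    rw [pow_succ', mul_smul]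
    rintro _ ⟨y, hy, rfl⟩
    exact Submodule.smul_mem_smul haI hy
  have h := length_quotient_le_of_le hle
  rw [length_quotient_pow_succ, length_quotient_map_smul a ha, add_comm] at h
  exact (ENat.add_le_add_iff_left hfin).mp h

theorem length_gradedPiece_le_succ (I : Ideal R) {x : R} (hx : x ∈ I) (n : ℕ)
    (h : ∀ y ∈ (I ^ n • ⊤ : Submodule R M),
      x • y ∈ (I ^ (n + 2) • ⊤ : Submodule R M) → y ∈ (I ^ (n + 1) • ⊤ : Submodule R M)) :
    Module.length R (gradedPiece I (M := M) n) ≤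
      Module.length R (gradedPiece I (M := M) (n + 1)) := by
  have hle (k : ℕ) : (I ^ k • ⊤ : Submodule R M) ≤
      (I ^ (k + 1) • ⊤ : Submodule R M).comap (LinearMap.lsmul R M x) := by
    rw [pow_succ', mul_smul]
    exact fun y hy => Submodule.smul_mem_smul hx hy
  let φ := Submodule.mapQ (I ^ (n + 1) • ⊤ : Submodule R M) _ (LinearMap.lsmul R M x) (hle (n + 1))
  have hφ : ∀ z ∈ gradedPiece I (M := M) n, φ z ∈ gradedPiece I (M := M) (n + 1) := by
    rintro _ ⟨y, hy, rfl⟩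
    exact Submodule.mem_map_of_mem (hle n hy)
  refine Module.length_le_of_injective (φ.restrict hφ) ?_
  rw [injective_iff_map_eq_zero]
  rintro ⟨_, y, hy, rfl⟩ hz
  refine Subtype.ext ((Submodule.Quotient.mk_eq_zero _).mpr (h y hy ?_))
  exact (Submodule.Quotient.mk_eq_zero _).mp (congrArg Subtype.val hz)

end Length

theorem length_ne_top_of_support_subset {R M : Type*} [CommRing R] [IsNoetherianRing R]
    [IsLocalRing R] [AddCommGroup M] [Module R M] [hM : Module.Finite R M]
    (h : Module.support R M ⊆ {IsLocalRing.closedPoint R}) : Module.length R M ≠ ⊤ := by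
  induction hM using IsNoetherianRing.induction_on_isQuotientEquivQuotientPrime R with
  | subsingleton N => simp [Module.length_eq_zero]
  | quotient N p e =>
    have hp : p = IsLocalRing.closedPoint R := h <| by
      rw [e.support_eq, Module.mem_support_iff_of_finite, Ideal.annihilator_quotient]
    have : IsSimpleModule R (R ⧸ p.asIdeal) := by
      rw [hp]
      exact isSimpleModule_iff_isCoatom.mpr
        (IsLocalRing.maximalIdeal.isMaximal R).out
    rw [e.length_eq, Module.length_eq_one]
    exact ENat.one_ne_top
  | exact A B C f g hf hg hfg ihA ihC =>
    rw [Module.support_of_exact hfg hf hg] at h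
    rw [Module.length_eq_add_of_exact f g hf hg hfg]
    exact WithTop.add_ne_top.mpr
      ⟨ihA (Set.subset_union_left.trans h), ihC (Set.subset_union_right.trans h)⟩

section Sequences

theorem eventually_const_of_eventually_le_succ {g : ℕ → ℕ} {c B : ℕ}
    (hg : ∀ n ≥ c, g n ≤ g (n + 1)) (hB : ∀ n ≥ c, g n ≤ B) :
    ∃ k, ∀ᶠ n in atTop, g n = k := by
  let g' : ℕ →o ℕ := ⟨fun n => g (c + n), monotone_nat_of_le_succ fun n => hg (c + n) (by lia)⟩
  have hbdd : BddAbove (Set.range g') := ⟨B, by rintro _ ⟨n, rfl⟩; exact hB _ (by lia)⟩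
  obtain ⟨m, hm⟩ := Nat.sSup_mem (Set.range_nonempty g') hbdd
  refine ⟨g (c + m), (eventually_ge_atTop (c + m)).mono fun n hn => le_antisymm ?_ ?_⟩
  · have := le_csSup hbdd ⟨n - c, rfl⟩
    rw [← hm] at this
    simpa [g', show c + (n - c) = n by lia] using this
  · have := g'.monotone (show m ≤ n - c by lia)
    simpa [g', show c + (n - c) = n by lia] using this

theorem tendsto_div_of_eventually_succ_eq {L : ℕ → ℕ} {k : ℕ}
    (h : ∀ᶠ n in atTop, L (n + 1) = k + L n) :
    Tendsto (fun n => (L n : ℝ) / n) atTop (nhds k) := by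
  obtain ⟨c, hc⟩ := eventually_atTop.mp h
  have hL : ∀ n ≥ c, (L n : ℝ) = n * k + (L c - c * k) := by
    intro n hn
    induction n, hn using Nat.le_induction with
    | base => ring
    | succ n hn ih =>
      rw [hc n hn]
      push_cast
      rw [ih]
      ring
  have hlim : Tendsto (fun n : ℕ => (k : ℝ) + (L c - c * k) / n) atTop (nhds (k + 0)) :=
    tendsto_const_nhds.add (tendsto_const_div_atTop_nhds_zero_nat _)
  rw [add_zero] at hlim
  refine hlim.congr' ((eventually_ge_atTop (max c 1)).mono fun n hn => ?_)
  have hn0 : (n : ℝ) ≠ 0 := by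
    have : n ≠ 0 := by lia
    exact_mod_cast this
  change _ = (L n : ℝ) / n
  rw [hL n (by lia)]
  field_simp

theorem eventually_eq_of_tendsto_div {L g : ℕ → ℕ} {c : ℕ} {e : ℝ}
    (hL : ∀ n, L (n + 1) = g n + L n) (hg : ∀ n ≥ c, g n ≤ g (n + 1))
    (he : Tendsto (fun n => (L n : ℝ) / n) atTop (nhds e)) :
    ∀ᶠ n in atTop, (g n : ℝ) = e := by
  have hmono : ∀ m ≥ c, ∀ n ≥ m, g m ≤ g n := by
    intro m hm n hn
    induction n, hn using Nat.le_induction with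
    | base => rfl
    | succ n hn ih => exact ih.trans (hg n (by lia))
  have hbound : ∀ m ≥ c, (g m : ℝ) ≤ e := by
    intro m hm
    have hlow : ∀ n ≥ m, (n - m) * g m ≤ L n := by
      intro n hn
      induction n, hn using Nat.le_induction with
      | base => simp
      | succ n hn ih =>
        rw [hL, show n + 1 - m = (n - m) + 1 by lia, add_mul, one_mul, add_comm]
        exact add_le_add (hmono m hm n hn) ih
    have hlim : Tendsto (fun n : ℕ => (g m : ℝ) - m * g m / n) atTop (nhds (g m - 0)) :=
      tendsto_const_nhds.sub (tendsto_const_div_atTop_nhds_zero_nat _)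
    rw [sub_zero] at hlim
    refine le_of_tendsto_of_tendsto hlim he
      ((eventually_ge_atTop (max m 1)).mono fun n hn => ?_)
    have hn0 : (0 : ℝ) < n := by
      have : 0 < n := by lia
      exact_mod_cast this
    have h : (((n - m) * g m : ℕ) : ℝ) ≤ L n := by exact_mod_cast hlow n (by lia)
    rw [Nat.cast_mul, Nat.cast_sub (by lia)] at h
    change (g m : ℝ) - m * g m / n ≤ L n / n
    rw [le_div_iff₀ hn0]
    field_simp
    linarith
  obtain ⟨k, hk⟩ := eventually_const_of_eventually_le_succ (B := ⌊e⌋₊) hg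
    fun n hn => Nat.le_floor (hbound n hn)
  have hke : (k : ℝ) = e := tendsto_nhds_unique
    (tendsto_div_of_eventually_succ_eq (hk.mono fun n hn => by rw [hL, hn])) he
  exact hk.mono fun n hn => by rw [hn, hke]

theorem tendsto_div_of_le_of_sub_le {a x : ℕ → ℕ} {c : ℕ} {e : ℝ}
    (ha : Tendsto (fun n => (a n : ℝ) / n) atTop (nhds e))
    (hle : ∀ n, x n ≤ a n) (hge : ∀ n ≥ c, a (n - c) ≤ x n) :
    Tendsto (fun n => (x n : ℝ) / n) atTop (nhds e) := by
  have h1 : Tendsto (fun n : ℕ => ((a (n - c) : ℝ) / (n - c : ℕ)) * (1 - c / n)) atTop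
      (nhds (e * (1 - 0))) :=
    (ha.comp (tendsto_sub_atTop_nat c)).mul
      (tendsto_const_nhds.sub (tendsto_const_div_atTop_nhds_zero_nat _))
  rw [sub_zero, mul_one] at h1
  refine tendsto_of_tendsto_of_tendsto_of_le_of_le' h1 ha
    ((eventually_ge_atTop (c + 1)).mono fun n hn => ?_) (Eventually.of_forall fun n => ?_)
  · have hn0 : (n : ℝ) ≠ 0 := by
      have : n ≠ 0 := by lia
      exact_mod_cast this
    have hnc : (n : ℝ) - c ≠ 0 := by
      have : ((n - c : ℕ) : ℝ) ≠ 0 := by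
        have : n - c ≠ 0 := by lia
        exact_mod_cast this
      rwa [Nat.cast_sub (by lia)] at this
    have : ((a (n - c) : ℝ) / (n - c : ℕ)) * (1 - c / n) = a (n - c) / n := by
      rw [Nat.cast_sub (by lia)]
      field_simp
    change _ * _ ≤ _
    rw [this]
    gcongr
    exact hge n (by lia)
  · change (x n : ℝ) / n ≤ a n / n
    gcongr
    exact hle n

end Sequences

section Dimension

variable {R : Type*} [CommRing R]

theorem not_lt_of_lt_of_ringKrullDim_quotient_le_one {J : Ideal R}
    (hJ : ringKrullDim (R ⧸ J) ≤ 1) {p q r : PrimeSpectrum R} (hp : J ≤ p.asIdeal) (hpq : p < q) :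
    ¬ q < r := by
  intro hqr
  rw [ringKrullDim_quotient] at hJ
  let z (s : PrimeSpectrum R) (hs : p ≤ s) : PrimeSpectrum.zeroLocus (J : Set R) :=
    ⟨s, hp.trans hs⟩
  let l : LTSeries (PrimeSpectrum.zeroLocus (J : Set R)) :=
    ((RelSeries.singleton _ (z p le_rfl)).snoc (z q hpq.le) hpq).snoc
      (z r (hpq.trans hqr).le) (by simpa using! hqr)
  have h := (Order.LTSeries.length_le_krullDim l).trans hJ
  have h2 : ((2 : ℕ) : WithBot ℕ∞) ≤ ((1 : ℕ) : WithBot ℕ∞) := by exact_mod_cast h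
  have h3 : (2 : ℕ) ≤ 1 := by exact_mod_cast h2
  lia

theorem one_le_ringKrullDim_quotient {p q : PrimeSpectrum R} (hpq : p < q) :
    1 ≤ ringKrullDim (R ⧸ p.asIdeal) := by
  rw [ringKrullDim_quotient]
  let z (s : PrimeSpectrum R) (hs : p ≤ s) : PrimeSpectrum.zeroLocus (p.asIdeal : Set R) :=
    ⟨s, hs⟩
  let l : LTSeries (PrimeSpectrum.zeroLocus (p.asIdeal : Set R)) :=
    (RelSeries.singleton _ (z p le_rfl)).snoc (z q hpq.le) hpq
  exact_mod_cast Order.LTSeries.length_le_krullDim l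

variable [IsLocalRing R]

theorem lt_closedPoint {p : PrimeSpectrum R} (hp : p ≠ IsLocalRing.closedPoint R) :
    p < IsLocalRing.closedPoint R :=
  lt_of_le_of_ne (IsLocalRing.le_maximalIdeal p.2.ne_top) hp

theorem eq_closedPoint_of_lt {p q : PrimeSpectrum R} (hp : ringKrullDim (R ⧸ p.asIdeal) = 1)
    (hpq : p < q) : q = IsLocalRing.closedPoint R := by
  by_contra hq
  exact not_lt_of_lt_of_ringKrullDim_quotient_le_one hp.le le_rfl hpq (lt_closedPoint hq)

end Dimension

/-- The primes `p` with `dim R/p = 1` and `I ⊄ p`. -/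
def transversePrimes {R : Type*} [CommRing R] (I : Ideal R) : Set (PrimeSpectrum R) :=
  {p | ringKrullDim (R ⧸ p.asIdeal) = (1 : WithBot ℕ∞) ∧ ¬ I ≤ p.asIdeal}

/-- The length of `M_p` over `R_p`. -/
def localLength {R : Type*} [CommRing R] (p : PrimeSpectrum R) (M : Type*) [AddCommGroup M]
    [Module R M] : ℕ∞ :=
  Module.length (Localization.AtPrime p.asIdeal) (LocalizedModule p.asIdeal.primeCompl M)

section LocalLength

variable {R : Type*} [CommRing R] (p : PrimeSpectrum R) {A B C : Type*} [AddCommGroup A]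
  [Module R A] [AddCommGroup B] [Module R B] [AddCommGroup C] [Module R C]

theorem localLength_eq_add_of_exact (f : A →ₗ[R] B) (g : B →ₗ[R] C)
    (hf : Function.Injective f) (hg : Function.Surjective g) (hfg : Function.Exact f g) :
    localLength p B = localLength p A + localLength p C :=
  Module.length_eq_add_of_exact (LocalizedModule.map p.asIdeal.primeCompl f)
    (LocalizedModule.map p.asIdeal.primeCompl g) (LocalizedModule.map_injective _ f hf)
    (LocalizedModule.map_surjective _ g hg) (LocalizedModule.map_exact _ f g hfg)

theorem localLength_eq_zero_iff : localLength p A = 0 ↔ p ∉ Module.support R A := by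
  rw [localLength, Module.length_eq_zero_iff, Module.notMem_support_iff]

theorem localLength_congr (e : A ≃ₗ[R] B) : localLength p A = localLength p B := by
  rw [localLength_eq_add_of_exact p e.toLinearMap (0 : B →ₗ[R] PUnit) e.injective
    (Function.surjective_to_subsingleton _)
    ((LinearMap.exact_zero_iff_surjective _ _).mpr e.surjective),
    (localLength_eq_zero_iff (A := PUnit) p).mpr (by simp [Module.support_eq_empty]), add_zero]

theorem localLength_quotient_self : localLength p (R ⧸ p.asIdeal) = 1 := by
  have hne : Nontrivial (LocalizedModule p.asIdeal.primeCompl (R ⧸ p.asIdeal)) := by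
    rw [← Module.mem_support_iff (R := R) (M := R ⧸ p.asIdeal) (p := p),
      Module.mem_support_iff_of_finite, Ideal.annihilator_quotient]
  rw [localLength, Module.length_eq_one_iff, isSimpleModule_iff_toSpanSingleton_surjective]
  refine ⟨hne, fun x hx y => ?_⟩
  induction x using LocalizedModule.induction_on with | _ a s
  induction y using LocalizedModule.induction_on with | _ b u
  obtain ⟨r, rfl⟩ := Ideal.Quotient.mk_surjective a
  obtain ⟨t, rfl⟩ := Ideal.Quotient.mk_surjective b
  have hr : r ∉ p.asIdeal := fun h => hx <| by
    rw [Ideal.Quotient.eq_zero_iff_mem.mpr h, LocalizedModule.zero_mk]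
  refine ⟨Localization.mk (t * s) (u * ⟨r, hr⟩), ?_⟩
  rw [LinearMap.toSpanSingleton_apply, LocalizedModule.mk_smul_mk, LocalizedModule.mk_eq]
  refine ⟨1, ?_⟩
  simp only [Submonoid.smul_def, Algebra.smul_def, Ideal.Quotient.algebraMap_eq, ← map_mul]
  congr 1
  simp
  ring

end LocalLength
theorem mem_support_quotient_iff {R : Type*} [CommRing R] {p q : PrimeSpectrum R} :
    p ∈ Module.support R (R ⧸ q.asIdeal) ↔ q ≤ p := by
  rw [Module.mem_support_iff_of_finite, Ideal.annihilator_quotient]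
  rfl

section TransversePrimes

variable {R : Type*} [CommRing R] [IsLocalRing R] {I : Ideal R}

theorem notMem_transversePrimes_closedPoint (hI : I ≠ ⊤) :
    IsLocalRing.closedPoint R ∉ transversePrimes I :=
  fun h => h.2 (IsLocalRing.le_maximalIdeal hI)

theorem eq_of_le_of_mem_transversePrimes {p q : PrimeSpectrum R} (hI : I ≠ ⊤)
    (hp : p ∈ transversePrimes I) (hq : q ∈ transversePrimes I) (hqp : q ≤ p) : q = p := by
  refine hqp.eq_of_not_lt fun hlt => ?_
  rw [eq_closedPoint_of_lt hq.1 hlt] at hp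
  exact notMem_transversePrimes_closedPoint hI hp

end TransversePrimes

section TransverseSupport

variable {R : Type*} [CommRing R] [IsNoetherianRing R] [IsLocalRing R] {I : Ideal R}
  {N : Type*} [AddCommGroup N] [Module R N] [Module.Finite R N]

theorem length_quotient_pow_ne_top
    (h : Module.support R N ⊆ insert (IsLocalRing.closedPoint R) (transversePrimes I)) (n : ℕ) :
    Module.length R (N ⧸ (I ^ n • ⊤ : Submodule R N)) ≠ ⊤ := by
  refine length_ne_top_of_support_subset ?_
  rw [Module.support_quotient]
  rintro p ⟨hp, hIp⟩
  refine (h hp).resolve_right fun hpt => hpt.2 ?_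
  exact p.2.le_of_pow_le hIp

theorem exists_tendsto_length_quotient_pow_div [Infinite (IsLocalRing.ResidueField R)]
    (h : Module.support R N ⊆ insert (IsLocalRing.closedPoint R) (transversePrimes I))
    {a : R} (haI : a ∈ I) (ha : Function.Injective (LinearMap.lsmul R N a))
    (haN : Module.support R (N ⧸ LinearMap.range (LinearMap.lsmul R N a)) ⊆
      {IsLocalRing.closedPoint R}) :
    ∃ k : ℕ, Tendsto (fun n : ℕ =>
      ((Module.length R (N ⧸ (I ^ n • ⊤ : Submodule R N))).toNat : ℝ) / n) atTop (nhds k) := by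
  have hfin := length_quotient_pow_ne_top h
  have hsucc := length_quotient_pow_succ I (M := N)
  have hg : ∀ n, Module.length R (gradedPiece I (M := N) n) ≠ ⊤ := fun n hn =>
    hfin (n + 1) (by rw [hsucc, hn, top_add])
  have haN' := length_ne_top_of_support_subset haN
  obtain ⟨x, hxI, c, hx⟩ := exists_superficial_element N I
  obtain ⟨k, hk⟩ := eventually_const_of_eventually_le_succ (c := c)
    (g := fun n => (Module.length R (gradedPiece I (M := N) n)).toNat)
    (fun n hn => ENat.toNat_le_toNat (length_gradedPiece_le_succ I hxI n (hx n hn)) (hg _))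
    (fun n _ => ENat.toNat_le_toNat (length_gradedPiece_le I haI ha n (hfin n)) haN')
  refine ⟨k, tendsto_div_of_eventually_succ_eq (hk.mono fun n hn => ?_)⟩
  rw [hsucc, ENat.toNat_add (hg n) (hfin n), hn]

open scoped Pointwise in
theorem tendsto_length_quotient_prime [Infinite (IsLocalRing.ResidueField R)]
    {p : PrimeSpectrum R} (hp : p ∈ transversePrimes I) :
    Tendsto (fun n : ℕ =>
      ((Module.length R ((R ⧸ p.asIdeal) ⧸ (I ^ n • ⊤ : Submodule R (R ⧸ p.asIdeal)))).toNat : ℝ)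
        / n) atTop (nhds (hsMult I (R ⧸ p.asIdeal) 1)) := by
  obtain ⟨a, haI, hap⟩ := SetLike.not_le_iff_exists.mp hp.2
  have hs : Module.support R (R ⧸ p.asIdeal) ⊆
      insert (IsLocalRing.closedPoint R) (transversePrimes I) := fun q hq => by
    rcases (mem_support_quotient_iff.mp hq).eq_or_lt with rfl | hlt
    · exact Or.inr hp
    · exact Or.inl (eq_closedPoint_of_lt hp.1 hlt)
  obtain ⟨k, hk⟩ := exists_tendsto_length_quotient_pow_div hs haI (a := a)
    (by
      rw [injective_iff_map_eq_zero]
      intro y hy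
      obtain ⟨r, rfl⟩ := Ideal.Quotient.mk_surjective y
      rw [LinearMap.lsmul_apply, Algebra.smul_def, Ideal.Quotient.algebraMap_eq, ← map_mul,
        Ideal.Quotient.eq_zero_iff_mem] at hy
      exact Ideal.Quotient.eq_zero_iff_mem.mpr ((p.2.mem_or_mem hy).resolve_left hap))
    (by
      have hr : LinearMap.range (LinearMap.lsmul R (R ⧸ p.asIdeal) a) = a • ⊤ :=
        (Submodule.map_top _).symm
      rw [hr]
      change Module.support R (QuotSMulTop a (R ⧸ p.asIdeal)) ⊆ _
      rw [Module.support_quotSMulTop]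
      rintro q ⟨hq, haq⟩
      rcases (mem_support_quotient_iff.mp hq).eq_or_lt with rfl | hlt
      · exact (hap (by simpa using haq)).elim
      · exact eq_closedPoint_of_lt hp.1 hlt)
  have : hsMult I (R ⧸ p.asIdeal) 1 = k := by
    refine Tendsto.limUnder_eq (hk.congr fun n => ?_)
    rw [mLength_eq_length, Nat.factorial_one, pow_one, Nat.cast_one, one_div, div_eq_inv_mul]
  rwa [this]

end TransverseSupport

section Exact

variable {R : Type*} [CommRing R] {A B C : Type*} [AddCommGroup A] [Module R A] [AddCommGroup B]
  [Module R B] [AddCommGroup C] [Module R C]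

theorem length_quotient_eq_add_of_exact {f : A →ₗ[R] B} {g : B →ₗ[R] C}
    (hg : Function.Surjective g) (hfg : Function.Exact f g) (K : Submodule R B) :
    Module.length R (B ⧸ K) = Module.length R (A ⧸ K.comap f) + Module.length R (C ⧸ K.map g) := by
  refine Module.length_eq_add_of_exact (Submodule.mapQ (K.comap f) K f le_rfl)
    (Submodule.mapQ K (K.map g) g (Submodule.le_comap_map g K)) ?_ ?_ ?_
  · rw [← LinearMap.ker_eq_bot, Submodule.ker_mapQ, Submodule.mkQ_map_self]
  · rw [← LinearMap.range_eq_top, Submodule.range_mapQ, LinearMap.range_eq_top.mpr hg,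
      Submodule.map_top, Submodule.range_mkQ]
  · rw [LinearMap.exact_iff, Submodule.ker_mapQ, Submodule.range_mapQ, Submodule.comap_map_eq,
      Submodule.map_sup, Submodule.mkQ_map_self, bot_sup_eq, hfg.linearMap_ker_eq]

theorem exists_comap_pow_smul_le [IsNoetherianRing R] [Module.Finite R B] (I : Ideal R)
    (f : A →ₗ[R] B) (hf : Function.Injective f) :
    ∃ c : ℕ, ∀ n ≥ c, (I ^ n • ⊤ : Submodule R B).comap f ≤ I ^ (n - c) • ⊤ := by
  obtain ⟨c, hc⟩ := I.exists_pow_inf_eq_pow_smul (LinearMap.range f)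
  refine ⟨c, fun n hn y hy => ?_⟩
  have hle : I ^ (n - c) • (I ^ c • ⊤ ⊓ LinearMap.range f) ≤
      (I ^ (n - c) • ⊤ : Submodule R A).map f := by
    rw [Submodule.map_smul'', Submodule.map_top]
    exact smul_mono_right _ inf_le_right
  obtain ⟨z, hz, hzy⟩ := hle ((hc n hn).le ⟨hy, y, rfl⟩)
  rwa [← hf hzy]

theorem tendsto_length_quotient_pow_div_of_exact [IsNoetherianRing R] [Module.Finite R B]
    {I : Ideal R} {f : A →ₗ[R] B} {g : B →ₗ[R] C} (hf : Function.Injective f)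
    (hg : Function.Surjective g) (hfg : Function.Exact f g) {a c : ℝ}
    (hA : ∀ n, Module.length R (A ⧸ (I ^ n • ⊤ : Submodule R A)) ≠ ⊤)
    (hC : ∀ n, Module.length R (C ⧸ (I ^ n • ⊤ : Submodule R C)) ≠ ⊤)
    (ha : Tendsto (fun n : ℕ =>
      ((Module.length R (A ⧸ (I ^ n • ⊤ : Submodule R A))).toNat : ℝ) / n) atTop (nhds a))
    (hc : Tendsto (fun n : ℕ =>
      ((Module.length R (C ⧸ (I ^ n • ⊤ : Submodule R C))).toNat : ℝ) / n) atTop (nhds c)) :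
    Tendsto (fun n : ℕ =>
      ((Module.length R (B ⧸ (I ^ n • ⊤ : Submodule R B))).toNat : ℝ) / n) atTop
        (nhds (a + c)) := by
  have hle (n : ℕ) : (I ^ n • ⊤ : Submodule R A) ≤ (I ^ n • ⊤ : Submodule R B).comap f := by
    rw [← Submodule.map_le_iff_le_comap, Submodule.map_smul'']
    exact smul_mono_right _ le_top
  have hmap (n : ℕ) : (I ^ n • ⊤ : Submodule R B).map g = I ^ n • ⊤ := by
    rw [Submodule.map_smul'', Submodule.map_top, LinearMap.range_eq_top.mpr hg]
  have hfin (n : ℕ) : Module.length R (A ⧸ (I ^ n • ⊤ : Submodule R B).comap f) ≠ ⊤ :=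
    ne_top_of_le_ne_top (hA n) (length_quotient_le_of_le (hle n))
  obtain ⟨k, hk⟩ := exists_comap_pow_smul_le I f hf
  refine ((tendsto_div_of_le_of_sub_le (c := k)
    (x := fun n => (Module.length R (A ⧸ (I ^ n • ⊤ : Submodule R B).comap f)).toNat) ha
    (fun n => ENat.toNat_le_toNat (length_quotient_le_of_le (hle n)) (hA n))
    fun n hn => ENat.toNat_le_toNat (length_quotient_le_of_le (hk n hn)) (hfin n)).add hc).congr
    fun n => ?_
  rw [length_quotient_eq_add_of_exact hg hfg, hmap, ENat.toNat_add (hfin n) (hC n), Nat.cast_add,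
    add_div]

end Exact

open Classical in
/-- The sum `∑ length (M_p) * e(I; R/p)` over the transverse primes `p` of `I`. -/
def transverseSum {R : Type*} [CommRing R] (I : Ideal R) (M : Type*) [AddCommGroup M]
    [Module R M] : ℝ :=
  ∑ᶠ p : PrimeSpectrum R, if p ∈ transversePrimes I then
    ((localLength p M).toNat : ℝ) * hsMult I (R ⧸ p.asIdeal) 1 else 0

theorem localLength_finite_and_tendsto_transverseSum {R : Type*} [CommRing R] [IsNoetherianRing R]
    [IsLocalRing R] [Infinite (IsLocalRing.ResidueField R)] {I : Ideal R} (hI : I ≠ ⊤) {N : Type*}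
    [AddCommGroup N] [Module R N] [hN : Module.Finite R N]
    (h : Module.support R N ⊆ insert (IsLocalRing.closedPoint R) (transversePrimes I)) :
    (∀ p ∈ transversePrimes I, localLength p N ≠ ⊤) ∧
    {p ∈ transversePrimes I | localLength p N ≠ 0}.Finite ∧
    Tendsto (fun n : ℕ =>
      ((Module.length R (N ⧸ (I ^ n • ⊤ : Submodule R N))).toNat : ℝ) / n) atTop
        (nhds (transverseSum I N)) := by
  induction hN using IsNoetherianRing.induction_on_isQuotientEquivQuotientPrime R with
  | subsingleton N =>
    have h0 (p : PrimeSpectrum R) : localLength p N = 0 := by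
      simp [localLength_eq_zero_iff, Module.support_eq_empty]
    refine ⟨by simp [h0], by simp [h0], ?_⟩
    simp [transverseSum, h0, Module.length_eq_zero]
  | quotient N q e =>
    have hloc (p : PrimeSpectrum R) (hp : p ∈ transversePrimes I) (hqp : q ≠ p) :
        localLength p N = 0 := by
      rw [localLength_eq_zero_iff, e.support_eq, mem_support_quotient_iff]
      intro hle
      rcases h (by rw [e.support_eq, mem_support_quotient_iff] : q ∈ _) with rfl | hq
      · exact hqp (hle.antisymm (IsLocalRing.le_maximalIdeal p.2.ne_top))
      · exact hqp (eq_of_le_of_mem_transversePrimes hI hp hq hle)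
    have hlocq : localLength q N = 1 := by
      rw [localLength_congr q e, localLength_quotient_self]
    refine ⟨fun p hp => ?_, (Set.finite_singleton q).subset fun p hp => ?_, ?_⟩
    · by_cases hqp : q = p
      · subst hqp
        simp [hlocq]
      · simp [hloc p hp hqp]
    · by_contra hqp
      exact hp.2 (hloc p hp.1 (Ne.symm hqp))
    · classical
      have hsum : transverseSum I N = if q ∈ transversePrimes I then
          hsMult I (R ⧸ q.asIdeal) 1 else 0 := by
        rw [transverseSum, finsum_eq_single _ q]
        · simp [hlocq]
        · intro p hpq
          split_ifs with hp
          · simp [hloc p hp hpq.symm]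
          · rfl
      rcases h (by rw [e.support_eq, mem_support_quotient_iff] : q ∈ _) with rfl | hq
      · rw [hsum, if_neg (notMem_transversePrimes_closedPoint hI)]
        have hN : Module.length R N ≠ ⊤ := length_ne_top_of_support_subset fun p hp => by
          rw [e.support_eq, mem_support_quotient_iff] at hp
          exact le_antisymm
            (IsLocalRing.le_maximalIdeal p.2.ne_top : p ≤ IsLocalRing.closedPoint R) hp
        refine squeeze_zero (fun n => by positivity) (fun n => ?_)
          (tendsto_const_div_atTop_nhds_zero_nat ((Module.length R N).toNat : ℝ))
        gcongr
        exact Module.length_le_of_surjective _ (Submodule.mkQ_surjective _)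
      · rw [hsum, if_pos hq]
        refine (tendsto_length_quotient_prime hq).congr fun n => ?_
        rw [(Submodule.Quotient.equiv (I ^ n • ⊤ : Submodule R N) (I ^ n • ⊤) e ?_).length_eq]
        rw [Submodule.map_smul'', Submodule.map_top]
        exact congrArg _ (LinearMap.range_eq_top.mpr e.surjective)
  | exact A B C f g hf hg hfg ihA ihC =>
    rw [Module.support_of_exact hfg hf hg] at h
    have hA := Set.subset_union_left.trans h
    have hC := Set.subset_union_right.trans h
    obtain ⟨hA1, hA2, hA3⟩ := ihA hA
    obtain ⟨hC1, hC2, hC3⟩ := ihC hC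
    have hadd (p : PrimeSpectrum R) := localLength_eq_add_of_exact p f g hf hg hfg
    refine ⟨fun p hp => ?_, (hA2.union hC2).subset fun p hp => ?_, ?_⟩
    · rw [hadd]
      exact WithTop.add_ne_top.mpr ⟨hA1 p hp, hC1 p hp⟩
    · by_contra hn
      simp only [Set.mem_union, Set.mem_ofPred_eq, hp.1, true_and, not_or, not_not] at hn
      exact hp.2 (by rw [hadd, hn.1, hn.2, add_zero])
    · have hsum : transverseSum I B = transverseSum I A + transverseSum I C := by
        rw [transverseSum, transverseSum, transverseSum, ← finsum_add_distrib]
        · refine finsum_congr fun p => ?_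
          split_ifs with hp
          · rw [hadd, ENat.toNat_add (hA1 p hp) (hC1 p hp), Nat.cast_add, add_mul]
          · rw [add_zero]
        · refine hA2.subset fun p hp => ?_
          by_contra hn
          simp_all
        · refine hC2.subset fun p hp => ?_
          by_contra hn
          simp_all
      rw [hsum]
      exact tendsto_length_quotient_pow_div_of_exact hf hg hfg (length_quotient_pow_ne_top hA)
        (length_quotient_pow_ne_top hC) hA3 hC3

theorem H0_maximalIdeal_eq_top {R M : Type*} [CommRing R] [IsLocalRing R] [AddCommGroup M]
    [Module R M] (hM : Module.length R M ≠ ⊤) :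
    H0 (IsLocalRing.maximalIdeal R) M = ⊤ := by
  set m := IsLocalRing.maximalIdeal R
  obtain ⟨_, _⟩ := isFiniteLength_iff_isNoetherian_isArtinian.mp (Module.length_ne_top_iff.mp hM)
  obtain ⟨n, hn⟩ := IsArtinian.monotone_stabilizes
    (⟨fun k => OrderDual.toDual (m ^ k • ⊤ : Submodule R M),
      fun _ _ h => Submodule.smul_mono_left (Ideal.pow_le_pow_right h)⟩ : ℕ →o (Submodule R M)ᵒᵈ)
  have hbot : (m ^ n • ⊤ : Submodule R M) = ⊥ := by
    refine Submodule.eq_bot_of_le_smul_of_le_jacobson_bot m _ (IsNoetherian.noetherian _) ?_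
      (IsLocalRing.maximalIdeal_le_jacobson _)
    rw [← mul_smul, ← pow_succ']
    exact (congrArg OrderDual.ofDual (hn (n + 1) n.le_succ)).le
  refine eq_top_iff.mpr (le_trans (fun y _ => ?_) (le_iSup _ n))
  refine (Submodule.mem_torsionBySet_iff _ _).mpr fun a => ?_
  exact (Submodule.mem_bot R).mp (hbot ▸ Submodule.smul_mem_smul a.2 trivial)

section Torsion

variable {R M : Type*} [CommRing R] [IsNoetherianRing R] [AddCommGroup M] [Module R M]
  [Module.Finite R M]

theorem exists_forall_mem_pow_smul_eq_zero (I : Ideal R) :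
    ∃ c : ℕ, ∀ y ∈ (I ^ c • ⊤ : Submodule R M), (∀ a ∈ I, a • y = 0) → y = 0 := by
  obtain ⟨k, hk⟩ := I.exists_pow_inf_eq_pow_smul (Submodule.torsionBySet R M I)
  refine ⟨k + 1, fun y hy hIy => ?_⟩
  have h : y ∈ (I ^ (k + 1) • ⊤ : Submodule R M) ⊓ Submodule.torsionBySet R M I :=
    ⟨hy, (Submodule.mem_torsionBySet_iff _ _).mpr fun a => hIy a a.2⟩
  rw [hk (k + 1) k.le_succ, Nat.add_sub_cancel_left, pow_one] at h
  refine (Submodule.mem_bot R).mp (Submodule.smul_le.mpr (fun a ha z hz => ?_) h)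
  exact (Submodule.mem_bot R).mpr ((Submodule.mem_torsionBySet_iff _ _).mp hz.2 ⟨a, ha⟩)

theorem support_subset_insert_transversePrimes [IsLocalRing R] {I J : Ideal R}
    (hJ : ringKrullDim (R ⧸ J) ≤ 1) (hJM : J ≤ Module.annihilator R M)
    (hM : ∀ y : M, (∀ a ∈ I, a • y = 0) → y = 0) :
    Module.support R M ⊆ insert (IsLocalRing.closedPoint R) (transversePrimes I) := by
  intro p hp
  refine or_iff_not_imp_left.mpr fun hpm => ?_
  have hpm := lt_closedPoint hpm
  have hMp := Module.annihilator_le_of_mem_support hp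
  refine ⟨le_antisymm ((ringKrullDim_le_of_surjective _
    (Ideal.Quotient.factor_surjective (hJM.trans hMp))).trans hJ)
    (one_le_ringKrullDim_quotient hpm), fun hIp => ?_⟩
  obtain ⟨q, hq, hqp⟩ := Ideal.exists_minimalPrimes_le hMp
  obtain ⟨hqprime, y, hy⟩ := (isAssociatedPrime_iff ..).mp
    (Module.associatedPrimes.minimalPrimes_annihilator_subset_associatedPrimes R M hq)
  have hIq : ¬ I ≤ q := fun hIq => by
    have hy0 : y = 0 := hM y fun a ha => by
      have := hIq ha
      rw [hy, Submodule.mem_colon_singleton] at this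
      simpa using this
    refine hqprime.ne_top ((Ideal.eq_top_iff_one q).mpr ?_)
    rw [hy, hy0]
    simp [Submodule.mem_colon_singleton]
  refine not_lt_of_lt_of_ringKrullDim_quotient_le_one hJ (p := ⟨q, hqprime⟩) (hJM.trans hq.1.2)
    (lt_of_le_of_ne hqp ?_) hpm
  rintro rfl
  exact hIq hIp

end Torsion

section PowSMul

variable {R M : Type*} [CommRing R] [AddCommGroup M] [Module R M]

theorem length_gradedPiece_pow_smul (I : Ideal R) (c n : ℕ) :
    Module.length R (gradedPiece I (M := (I ^ c • ⊤ : Submodule R M)) n) =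
      Module.length R (gradedPiece I (M := M) (n + c)) := by
  set N : Submodule R M := I ^ c • ⊤
  have hmap (k : ℕ) : (I ^ k • ⊤ : Submodule R N).map N.subtype = I ^ (k + c) • ⊤ := by
    rw [Submodule.map_smul'', Submodule.map_top, Submodule.range_subtype, pow_add, mul_smul]
  have hcomap : (I ^ (n + c + 1) • ⊤ : Submodule R M).comap N.subtype = I ^ (n + 1) • ⊤ := by
    rw [add_right_comm, ← hmap, Submodule.comap_map_eq_of_injective N.injective_subtype]
  let φ := Submodule.mapQ (I ^ (n + 1) • ⊤ : Submodule R N) (I ^ (n + c + 1) • ⊤) N.subtype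
    hcomap.ge
  have hφ : Function.Injective φ := by
    rw [← LinearMap.ker_eq_bot, Submodule.ker_mapQ, hcomap, Submodule.mkQ_map_self]
  rw [(Submodule.equivMapOfInjective φ hφ (gradedPiece I n)).length_eq]
  have : (gradedPiece I n).map φ = gradedPiece I (n + c) := by
    rw [gradedPiece, gradedPiece, ← Submodule.map_comp, Submodule.mapQ_mkQ, Submodule.map_comp,
      hmap]
  rw [this]

theorem localLength_pow_smul [Module.Finite R M] {I : Ideal R} {p : PrimeSpectrum R}
    (hp : p ∈ transversePrimes I) (c : ℕ) :
    localLength p (I ^ c • ⊤ : Submodule R M) = localLength p M := by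
  rw [localLength_eq_add_of_exact p (Submodule.subtype (I ^ c • ⊤ : Submodule R M))
    (Submodule.mkQ _) (Submodule.injective_subtype _) (Submodule.mkQ_surjective _)
    (LinearMap.exact_subtype_mkQ _), (localLength_eq_zero_iff p (A := M ⧸ _)).mpr, add_zero]
  rw [Module.support_quotient]
  exact fun h => hp.2 (p.2.le_of_pow_le h.2)

end PowSMul

theorem jMult_one_eq_transverseSum {R : Type*} [CommRing R] [IsNoetherianRing R] [IsLocalRing R]
    [Infinite (IsLocalRing.ResidueField R)] {I : Ideal R} (hI : I ≠ ⊤) {M : Type*}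
    [AddCommGroup M] [Module R M] [Module.Finite R M] (hM : mDim R M ≤ 1) :
    jMult (IsLocalRing.maximalIdeal R) I M 1 = transverseSum I M := by
  obtain ⟨c, hc⟩ := exists_forall_mem_pow_smul_eq_zero (M := M) I
  set N : Submodule R M := I ^ c • ⊤
  have hN := support_subset_insert_transversePrimes (M := N) hM
    (LinearMap.annihilator_le_of_injective N.subtype N.injective_subtype)
    fun y hy => Subtype.ext (hc y y.2 fun a ha => congrArg Subtype.val (hy a ha))
  have hlim := (localLength_finite_and_tendsto_transverseSum hI hN).2.2
  have hsum : transverseSum I N = transverseSum I M := by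
    refine finsum_congr fun p => ?_
    split_ifs with hp
    · rw [localLength_pow_smul hp c]
    · rfl
  have hfin := length_quotient_pow_ne_top hN
  have hsucc := length_quotient_pow_succ I (M := N)
  have hg : ∀ n, Module.length R (gradedPiece I (M := N) n) ≠ ⊤ := fun n hn =>
    hfin (n + 1) (by rw [hsucc, hn, top_add])
  obtain ⟨x, hxI, b, hx⟩ := exists_superficial_element N I
  have hev := eventually_eq_of_tendsto_div (c := b)
    (g := fun n => (Module.length R (gradedPiece I (M := N) n)).toNat)
    (fun n => by rw [hsucc, ENat.toNat_add (hg n) (hfin n)])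
    (fun n hn => ENat.toNat_le_toNat (length_gradedPiece_le_succ I hxI n (hx n hn)) (hg _)) hlim
  refine Tendsto.limUnder_eq ((tendsto_add_atTop_iff_nat c).mp ?_)
  refine tendsto_const_nhds.congr' (hev.mono fun n hn => ?_)
  have hgM := hg n
  rw [length_gradedPiece_pow_smul] at hn hgM
  beta_reduce
  rw [mLength_eq_length, H0_maximalIdeal_eq_top hgM, Module.length_top, hn, hsum]
  simp

open Classical in
/-- Lemma 3.7: if `dim M ≤ 1` then
`j₁(I, M) = Σ_{𝔭 ∈ 𝒫} length_{R_𝔭}(M_𝔭) · e(I; R/𝔭)`, where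
`𝒫 = {𝔭 ∈ Spec R : dim R/𝔭 = 1, I ⊄ 𝔭}`. -/
theorem stmt_14 {R : Type*} [CommRing R] [IsNoetherianRing R] [IsLocalRing R]
    (hdim : 0 < ringKrullDim R) (hres : Infinite (IsLocalRing.ResidueField R))
    (I : Ideal R) (hI : I ≠ ⊤)
    (M : Type*) [AddCommGroup M] [Module R M] [Module.Finite R M]
    (hM1 : mDim R M ≤ (1 : WithBot ℕ∞)) :
    jMult (IsLocalRing.maximalIdeal R) I M 1 =
      ∑ᶠ p : PrimeSpectrum R,
        if ringKrullDim (R ⧸ p.asIdeal) = (1 : WithBot ℕ∞) ∧ ¬ I ≤ p.asIdeal then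
          ((mLength (Localization.AtPrime p.asIdeal)
              (LocalizedModule p.asIdeal.primeCompl M)).toNat : ℝ) *
            hsMult I (R ⧸ p.asIdeal) 1
        else 0 := by
  rw [jMult_one_eq_transverseSum hI hM1, transverseSum]
  refine finsum_congr fun p => ?_
  rw [mLength_eq_length]
  exact if_congr Iff.rfl rfl rfl

end
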